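/- arXiv:1705.05292 — 5 statements merged into one kernel-verified Lean document; each statement's English description precedes it below -/
import Mathlib

section
/- Let (X,B,μ) be a measure space and let G be a real-valued function on the set of finite measurable partitions of X such that whenever a partition α refines a partition β (α ≽ β) one has G(α) ≥ G(β). Then for every finite measurable cover U = {U_1,...,U_M} of X, the infimum of G(α) over all finite measurable partitions α with α ≽ U equals the infimum of G(α) over all α in U*. -/
open MeasureTheory Real Filter

namespace Paper

variable {X : Type*} [MeasurableSpace X]

/-- `𝒰` is a finite cover of `X` (a finite family of sets whose union is `X`). -/
def IsCover (𝒰 : Finset (Set X)) : Prop :=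
  ⋃₀ (𝒰 : Set (Set X)) = Set.univ

/-- `𝒰` is a partition of `X`: a cover by pairwise disjoint sets. -/
def IsPartition (𝒰 : Finset (Set X)) : Prop :=
  IsCover 𝒰 ∧ ∀ A ∈ 𝒰, ∀ B ∈ 𝒰, A ≠ B → Disjoint A B

/-- All members of `𝒰` are measurable (Borel) sets. -/
def MeasF (𝒰 : Finset (Set X)) : Prop := ∀ A ∈ 𝒰, MeasurableSet A

/-- `𝒰 ≽ 𝒱` : every element of `𝒰` is contained in some element of `𝒱`. -/
def Refines (𝒰 𝒱 : Finset (Set X)) : Prop := ∀ A ∈ 𝒰, ∃ B ∈ 𝒱, A ⊆ B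

/-- The join `𝒰 ∨ 𝒱 = {U ∩ V : U ∈ 𝒰, V ∈ 𝒱}`. -/
noncomputable def join (𝒰 𝒱 : Finset (Set X)) : Finset (Set X) :=
  letI := Classical.decEq (Set X)
  (𝒰 ×ˢ 𝒱).image fun p => p.1 ∩ p.2

/-- The preimage cover `f⁻¹𝒰 = {f⁻¹U : U ∈ 𝒰}`. -/
noncomputable def pre {Y : Type*} (f : X → Y) (𝒰 : Finset (Set Y)) : Finset (Set X) :=
  letI := Classical.decEq (Set X)
  𝒰.image fun U => f ⁻¹' U

/-- `dynJoin f 𝒰 N = 𝒰_0^{N-1} = ⋁_{n=0}^{N-1} f^{-n} 𝒰` (equal to `{univ}` for `N = 0`). -/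
noncomputable def dynJoin (f : X → X) (𝒰 : Finset (Set X)) : ℕ → Finset (Set X)
  | 0 => {Set.univ}
  | (N + 1) => join (dynJoin f 𝒰 N) (pre (f^[N]) 𝒰)

/-- `N(𝒰 ∩ B)`: the minimal cardinality of a subfamily of `𝒰` whose union contains `B`. -/
noncomputable def covNum (𝒰 : Finset (Set X)) (B : Set X) : ℕ :=
  sInf {k : ℕ | ∃ 𝒱 ⊆ 𝒰, 𝒱.card = k ∧ B ⊆ ⋃₀ (𝒱 : Set (Set X))}

/-- `N(𝒰|β) = max_{B ∈ β} N(𝒰 ∩ B)`. -/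
noncomputable def covNumCond (𝒰 β : Finset (Set X)) : ℕ :=
  β.sup fun B => covNum 𝒰 B

/-- The entropy `H_μ(α) = -∑_{A ∈ α} μ(A) log μ(A)` of a finite family of sets. -/
noncomputable def entPart (μ : Measure X) (α : Finset (Set X)) : ℝ :=
  ∑ A ∈ α, negMulLog (μ A).toReal

/-- Conditional entropy `H_μ(α|β) = ∑_{B ∈ β} μ(B) H_{μ_B}(α)`, where `μ_B` is the
conditional measure (which is `0` when `μ(B) = 0`). -/
noncomputable def entCondPart (μ : Measure X) (α β : Finset (Set X)) : ℝ :=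
  ∑ B ∈ β, (μ B).toReal * entPart (ProbabilityTheory.cond μ B) α

/-- `H_μ(𝒰) = inf { H_μ(α) : α a measurable partition finer than 𝒰 }`. -/
noncomputable def covEnt (μ : Measure X) (𝒰 : Finset (Set X)) : ℝ :=
  sInf {h : ℝ | ∃ α : Finset (Set X),
    IsPartition α ∧ MeasF α ∧ Refines α 𝒰 ∧ h = entPart μ α}

/-- `H_μ(𝒰|β) = ∑_{B ∈ β} μ(B) H_{μ_B}(𝒰)` for a cover `𝒰` and a partition `β`. -/
noncomputable def covEntCond (μ : Measure X) (𝒰 β : Finset (Set X)) : ℝ :=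
  ∑ B ∈ β, (μ B).toReal * covEnt (ProbabilityTheory.cond μ B) 𝒰

/-- `h_μ(α|β,f) = lim_N (1/N) H_μ(α_0^{N-1}|β_0^{N-1})`; by subadditivity the limit
equals the infimum. -/
noncomputable def hPart (f : X → X) (μ : Measure X) (α β : Finset (Set X)) : ℝ :=
  ⨅ N : ℕ, entCondPart μ (dynJoin f α (N + 1)) (dynJoin f β (N + 1)) / (N + 1 : ℝ)

/-- `h_μ^-(𝒰|β,f) = lim_N (1/N) H_μ(𝒰_0^{N-1}|β_0^{N-1})`; by subadditivity the limit
equals the infimum. -/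
noncomputable def hMinus (f : X → X) (μ : Measure X) (𝒰 β : Finset (Set X)) : ℝ :=
  ⨅ N : ℕ, covEntCond μ (dynJoin f 𝒰 (N + 1)) (dynJoin f β (N + 1)) / (N + 1 : ℝ)

/-- `h_μ^+(𝒰|β,f) = inf { h_μ(α|β,f) : α a measurable partition finer than 𝒰 }`. -/
noncomputable def hPlus (f : X → X) (μ : Measure X) (𝒰 β : Finset (Set X)) : ℝ :=
  sInf {h : ℝ | ∃ α : Finset (Set X),
    IsPartition α ∧ MeasF α ∧ Refines α 𝒰 ∧ h = hPart f μ α β}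

/-- The (combinatorial/topological) conditional entropy
`h(𝒰|β,f) = lim_N (1/N) log N(𝒰_0^{N-1}|β_0^{N-1})`; by subadditivity the limit
equals the infimum. -/
noncomputable def hTop (f : X → X) (𝒰 β : Finset (Set X)) : ℝ :=
  ⨅ N : ℕ, Real.log (covNumCond (dynJoin f 𝒰 (N + 1)) (dynJoin f β (N + 1))) / (N + 1 : ℝ)

/-- The finite family of sets associated to an indexed cover `{U_1, …, U_M}`. -/
noncomputable def rangeFinset {M : ℕ} (U : Fin M → Set X) : Finset (Set X) :=
  letI := Classical.decEq (Set X)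
  Finset.image U Finset.univ

end Paper

open Paper MeasureTheory Real Filter

/-- A measurable partition subordinate to a finite indexed family `U` can be coarsened to a
measurable partition whose `m`-th member is contained in `U m`. -/
theorem Paper.IsPartition.exists_indexed_coarsening {X : Type*} [MeasurableSpace X]
    {α : Finset (Set X)} (hα : IsPartition α) (hmeas : MeasF α) {M : ℕ} {U : Fin M → Set X}
    (hU : ∀ A ∈ α, ∃ m, A ⊆ U m) :
    ∃ B : Fin M → Set X, (∀ m, B m ⊆ U m) ∧ IsPartition (rangeFinset B) ∧
      MeasF (rangeFinset B) ∧ Refines α (rangeFinset B) := by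
  choose f hf using fun A : α => hU A A.2
  have mem_range (B : Fin M → Set X) (A : Set X) : A ∈ rangeFinset B ↔ ∃ m, B m = A := by
    simp [rangeFinset]
  let B : Fin M → Set X := fun m => ⋃ (A : α) (_ : f A = m), A
  have mem_B (m : Fin M) (x : X) : x ∈ B m ↔ ∃ A : α, f A = m ∧ x ∈ (A : Set X) := by
    simp only [B, Set.mem_iUnion, exists_prop]
  refine ⟨B, fun m x hx => ?_, ⟨?_, ?_⟩, ?_, fun A hA => ?_⟩
  · obtain ⟨A, rfl, hxA⟩ := (mem_B m x).1 hx
    exact hf A hxA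
  · refine Set.eq_univ_of_forall fun x => ?_
    obtain ⟨A, hA, hx⟩ : x ∈ ⋃₀ (α : Set (Set X)) := hα.1 ▸ Set.mem_univ x
    exact ⟨B (f ⟨A, hA⟩), (mem_range B _).2 ⟨_, rfl⟩, (mem_B _ x).2 ⟨⟨A, hA⟩, rfl, hx⟩⟩
  · intro C hC D hD hCD
    obtain ⟨m, rfl⟩ := (mem_range B C).1 hC
    obtain ⟨n, rfl⟩ := (mem_range B D).1 hD
    refine Set.disjoint_left.2 fun x hxm hxn => ?_
    obtain ⟨A, rfl, hxA⟩ := (mem_B m x).1 hxm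
    obtain ⟨A', rfl, hxA'⟩ := (mem_B n x).1 hxn
    have hne : (A : Set X) ≠ A' := fun h => hCD (by rw [Subtype.ext h])
    exact Set.disjoint_left.1 (hα.2 A A.2 A' A'.2 hne) hxA hxA'
  · intro C hC
    obtain ⟨m, rfl⟩ := (mem_range B C).1 hC
    exact MeasurableSet.iUnion fun A => MeasurableSet.iUnion fun _ => hmeas A A.2
  · exact ⟨B (f ⟨A, hA⟩), (mem_range B _).2 ⟨_, rfl⟩,
      fun x hx => (mem_B _ x).2 ⟨⟨A, hA⟩, rfl, hx⟩⟩

/-- For a measure space `(X, 𝓑, μ)` and a function `G` on finite measurable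
partitions that is monotone under refinement, for every finite measurable cover
`U = {U_1, …, U_M}` of `X`, the infimum of `G` over all measurable partitions finer than
`U` equals the infimum of `G` over the partitions in `U*`. -/
theorem statement0 {X : Type*} [MeasurableSpace X] (μ : MeasureTheory.Measure X)
    (G : Finset (Set X) → ℝ)
    (hG : ∀ α β : Finset (Set X), IsPartition α → MeasF α → IsPartition β → MeasF β →
      Refines α β → G β ≤ G α)
    {M : ℕ} (U : Fin M → Set X) (hUmeas : ∀ m, MeasurableSet (U m))
    (hUcov : (⋃ m, U m) = Set.univ) :
    sInf {g : ℝ | ∃ α : Finset (Set X), IsPartition α ∧ MeasF α ∧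
        (∀ A ∈ α, ∃ m, A ⊆ U m) ∧ g = G α} =
    sInf {g : ℝ | ∃ α : Finset (Set X), IsPartition α ∧ MeasF α ∧
        (∃ A : Fin M → Set X, (∀ m, A m ⊆ U m) ∧ α = rangeFinset A) ∧ g = G α} := by
  apply csInf_eq_csInf_of_forall_exists_le
  · rintro _ ⟨α, hα, hmeas, hU, rfl⟩
    obtain ⟨B, hBU, hB, hBmeas, href⟩ := hα.exists_indexed_coarsening hmeas hU
    exact ⟨_, ⟨_, hB, hBmeas, ⟨B, hBU, rfl⟩, rfl⟩, hG _ _ hα hmeas hB hBmeas href⟩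
  · rintro _ ⟨α, hα, hmeas, ⟨A, hAU, rfl⟩, rfl⟩
    refine ⟨_, ⟨_, hα, hmeas, fun C hC => ?_, rfl⟩, le_rfl⟩
    obtain ⟨m, rfl⟩ : ∃ m, A m = C := by simpa [rangeFinset] using hC
    exact ⟨m, hAU m⟩
end

section
/- Let X be a compact metric space, μ a Borel probability measure on X, U a cover of X and β a partition of X. Then H_μ(U|β) = H*_μ(U|β); that is, ∑_{B∈β} μ(B) · inf{H_{μ_B}(α) : α a partition with α ≽ U} = inf{H_μ(α|β) : α a partition with α ≽ U}. -/
open MeasureTheory Real Filter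

open Paper MeasureTheory Real Filter

namespace Paper

section

variable {X : Type*}

/-- The partition that agrees with `α B` on each `B ∈ β`: `{B ∩ A : B ∈ β, A ∈ α B}`. -/
noncomputable def glue (β : Finset (Set X)) (α : Set X → Finset (Set X)) : Finset (Set X) :=
  letI := Classical.decEq (Set X)
  β.biUnion fun B => (α B).image fun A => B ∩ A

lemma mem_glue {β : Finset (Set X)} {α : Set X → Finset (Set X)} {C : Set X} :
    C ∈ glue β α ↔ ∃ B ∈ β, ∃ A ∈ α B, B ∩ A = C := by
  classical
  simp [glue]

lemma IsPartition.glue {β : Finset (Set X)} {α : Set X → Finset (Set X)}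
    (hβ : IsPartition β) (hα : ∀ B, IsPartition (α B)) : IsPartition (glue β α) := by
  refine ⟨Set.eq_univ_of_forall fun x => ?_, ?_⟩
  · obtain ⟨B, hB, hxB⟩ : x ∈ ⋃₀ (β : Set (Set X)) := hβ.1 ▸ Set.mem_univ x
    obtain ⟨A, hA, hxA⟩ : x ∈ ⋃₀ (α B : Set (Set X)) := (hα B).1 ▸ Set.mem_univ x
    exact ⟨B ∩ A, mem_glue.2 ⟨B, hB, A, hA, rfl⟩, hxB, hxA⟩
  · intro C hC D hD hne
    obtain ⟨B, hB, A, hA, rfl⟩ := mem_glue.1 hC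
    obtain ⟨B', hB', A', hA', rfl⟩ := mem_glue.1 hD
    by_cases h : B = B'
    · subst h
      have hAA' : A ≠ A' := fun h => hne (h ▸ rfl)
      exact ((hα B).2 A hA A' hA' hAA').mono Set.inter_subset_right Set.inter_subset_right
    · exact (hβ.2 B hB B' hB' h).mono Set.inter_subset_left Set.inter_subset_left

lemma Refines.glue {𝒰 β : Finset (Set X)} {α : Set X → Finset (Set X)}
    (hα : ∀ B, Refines (α B) 𝒰) : Refines (glue β α) 𝒰 := by
  intro C hC
  obtain ⟨B, -, A, hA, rfl⟩ := mem_glue.1 hC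
  obtain ⟨U, hU, hAU⟩ := hα B A hA
  exact ⟨U, hU, Set.inter_subset_right.trans hAU⟩

end

variable {X : Type*} [MeasurableSpace X]

lemma MeasF.glue {β : Finset (Set X)} {α : Set X → Finset (Set X)}
    (hβ : MeasF β) (hα : ∀ B, MeasF (α B)) : MeasF (glue β α) := by
  intro C hC
  obtain ⟨B, hB, A, hA, rfl⟩ := mem_glue.1 hC
  exact (hβ B hB).inter (hα B A hA)

lemma entPart_nonneg (ν : Measure X) [IsZeroOrProbabilityMeasure ν] (α : Finset (Set X)) :
    0 ≤ entPart ν α :=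
  Finset.sum_nonneg fun A _ =>
    negMulLog_nonneg ENNReal.toReal_nonneg (measureReal_le_one (μ := ν) (s := A))

lemma entPart_cond_glue (μ : Measure X) {β : Finset (Set X)} {α : Set X → Finset (Set X)}
    (hβ : IsPartition β) (hβm : MeasF β) (hα : ∀ B, IsPartition (α B)) {B : Set X}
    (hB : B ∈ β) :
    entPart (ProbabilityTheory.cond μ B) (glue β α) =
      entPart (ProbabilityTheory.cond μ B) (α B) := by
  classical
  have hsub : (α B).image (fun A => B ∩ A) ⊆ glue β α := fun C hC => by
    obtain ⟨A, hA, rfl⟩ := Finset.mem_image.1 hC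
    exact mem_glue.2 ⟨B, hB, A, hA, rfl⟩
  unfold entPart
  rw [← Finset.sum_subset hsub, Finset.sum_image_of_disjoint]
  · refine Finset.sum_congr rfl fun A _ => ?_
    rw [ProbabilityTheory.cond_inter_self (hβm B hB)]
  · simp
  · intro A hA A' hA' hne
    exact ((hα B).2 A hA A' hA' hne).mono Set.inter_subset_right Set.inter_subset_right
  · intro C hC hCB
    obtain ⟨B', hB', A, hA, rfl⟩ := mem_glue.1 hC
    have hne : B ≠ B' := by
      rintro rfl
      exact hCB (Finset.mem_image_of_mem _ hA)
    have hempty : B ∩ (B' ∩ A) = ∅ :=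
      ((hβ.2 B hB B' hB' hne).mono_right Set.inter_subset_left).inter_eq
    simp [ProbabilityTheory.cond_apply (hβm B hB), hempty]

lemma IsPartition.sum_measure_toReal {β : Finset (Set X)} (hβ : IsPartition β) (hβm : MeasF β)
    (μ : Measure X) [IsProbabilityMeasure μ] : ∑ B ∈ β, (μ B).toReal = 1 := by
  rw [← ENNReal.toReal_sum fun B _ => measure_ne_top μ B,
    ← measure_biUnion_finset (f := fun B => B) (fun A hA B hB => hβ.2 A hA B hB) hβm]
  have : ⋃ B ∈ β, B = Set.univ := by
    rw [← hβ.1, Set.sUnion_eq_biUnion]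
    rfl
  simp [this]

lemma covEnt_le_entPart (ν : Measure X) [IsZeroOrProbabilityMeasure ν] {𝒰 α : Finset (Set X)}
    (hα : IsPartition α) (hαm : MeasF α) (hα𝒰 : Refines α 𝒰) : covEnt ν 𝒰 ≤ entPart ν α := by
  refine csInf_le ⟨0, ?_⟩ ⟨α, hα, hαm, hα𝒰, rfl⟩
  rintro _ ⟨γ, -, -, -, rfl⟩
  exact entPart_nonneg ν γ

lemma covEntCond_le_entCondPart (μ : Measure X) {𝒰 α : Finset (Set X)} (β : Finset (Set X))
    (hα : IsPartition α) (hαm : MeasF α) (hα𝒰 : Refines α 𝒰) :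
    covEntCond μ 𝒰 β ≤ entCondPart μ α β :=
  Finset.sum_le_sum fun _ _ =>
    mul_le_mul_of_nonneg_left (covEnt_le_entPart _ hα hαm hα𝒰) ENNReal.toReal_nonneg

lemma exists_entPart_lt (ν : Measure X) {𝒰 α₀ : Finset (Set X)} (hα₀ : IsPartition α₀)
    (hα₀m : MeasF α₀) (hα₀𝒰 : Refines α₀ 𝒰) {ε : ℝ} (hε : 0 < ε) :
    ∃ α : Finset (Set X), IsPartition α ∧ MeasF α ∧ Refines α 𝒰 ∧
      entPart ν α < covEnt ν 𝒰 + ε := by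
  obtain ⟨_, ⟨α, hα, hαm, hα𝒰, rfl⟩, hlt⟩ :=
    exists_lt_of_csInf_lt (⟨_, α₀, hα₀, hα₀m, hα₀𝒰, rfl⟩ : {h : ℝ | ∃ α : Finset (Set X),
      IsPartition α ∧ MeasF α ∧ Refines α 𝒰 ∧ h = entPart ν α}.Nonempty)
      (lt_add_of_pos_right (covEnt ν 𝒰) hε)
  exact ⟨α, hα, hαm, hα𝒰, hlt⟩

end Paper

/-- For a Borel probability measure `μ` on a compact metric space `X`,
a cover `𝒰` and a partition `β`:
`H_μ(𝒰|β) = H*_μ(𝒰|β)`, i.e. `∑_{B∈β} μ(B)·inf{H_{μ_B}(α) : α ≽ 𝒰}` equals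
`inf{H_μ(α|β) : α ≽ 𝒰}` (infima over finite measurable partitions). -/
theorem statement4 {X : Type*} [MetricSpace X] [CompactSpace X]
    [MeasurableSpace X] [BorelSpace X]
    (μ : MeasureTheory.Measure X) [MeasureTheory.IsProbabilityMeasure μ]
    (𝒰 β : Finset (Set X)) (h𝒰 : IsCover 𝒰) (h𝒰m : MeasF 𝒰)
    (hβ : IsPartition β) (hβm : MeasF β) :
    covEntCond μ 𝒰 β =
      sInf {h : ℝ | ∃ α : Finset (Set X),
        IsPartition α ∧ MeasF α ∧ Refines α 𝒰 ∧ h = entCondPart μ α β} := by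
  by_cases hne : ∃ α : Finset (Set X), IsPartition α ∧ MeasF α ∧ Refines α 𝒰
  · obtain ⟨α₀, hα₀, hα₀m, hα₀𝒰⟩ := hne
    apply le_antisymm
    · refine le_csInf ⟨_, α₀, hα₀, hα₀m, hα₀𝒰, rfl⟩ ?_
      rintro _ ⟨α, hα, hαm, hα𝒰, rfl⟩
      exact covEntCond_le_entCondPart μ β hα hαm hα𝒰
    · refine le_of_forall_pos_le_add fun ε hε => ?_
      choose α hα hαm hα𝒰 hlt using fun B : Set X =>
        exists_entPart_lt (ProbabilityTheory.cond μ B) hα₀ hα₀m hα₀𝒰 hε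
      have hbdd : BddBelow {h : ℝ | ∃ α : Finset (Set X),
          IsPartition α ∧ MeasF α ∧ Refines α 𝒰 ∧ h = entCondPart μ α β} := by
        refine ⟨covEntCond μ 𝒰 β, ?_⟩
        rintro _ ⟨γ, hγ, hγm, hγ𝒰, rfl⟩
        exact covEntCond_le_entCondPart μ β hγ hγm hγ𝒰
      calc _ ≤ entCondPart μ (glue β α) β :=
            csInf_le hbdd ⟨_, hβ.glue hα, hβm.glue hαm, Refines.glue hα𝒰, rfl⟩
        _ ≤ ∑ B ∈ β, (μ B).toReal * (covEnt (ProbabilityTheory.cond μ B) 𝒰 + ε) := by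
            refine Finset.sum_le_sum fun B hB => ?_
            rw [entPart_cond_glue μ hβ hβm hα hB]
            exact mul_le_mul_of_nonneg_left (hlt B).le ENNReal.toReal_nonneg
        _ = covEntCond μ 𝒰 β + ε := by
            simp only [mul_add, Finset.sum_add_distrib, ← Finset.sum_mul,
              hβ.sum_measure_toReal hβm μ, one_mul, covEntCond]
  · have hempty (f : Finset (Set X) → ℝ) : {h : ℝ | ∃ α : Finset (Set X),
        IsPartition α ∧ MeasF α ∧ Refines α 𝒰 ∧ h = f α} = ∅ := by
      refine Set.eq_empty_of_forall_notMem ?_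
      rintro _ ⟨α, hα, hαm, hα𝒰, -⟩
      exact hne ⟨α, hα, hαm, hα𝒰⟩
    simp [covEntCond, covEnt, hempty]
end

section
/- Let X be a compact metric space, μ a Borel probability measure on X, U a cover of X and β, γ partitions of X. If β ≽ γ then H_μ(U|β) ≤ H_μ(U|γ). -/
open MeasureTheory Real Filter

namespace Paper

variable {X : Type*} [MeasurableSpace X]

lemma toReal_mul_cond (μ : Measure X) [IsFiniteMeasure μ] {B : Set X} (hB : MeasurableSet B)
    (A : Set X) :
    (μ B).toReal * (ProbabilityTheory.cond μ B A).toReal = (μ (A ∩ B)).toReal := by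
  rw [← ENNReal.toReal_mul, mul_comm, ProbabilityTheory.cond_mul_eq_inter hB, Set.inter_comm]

lemma toReal_cond_le_one (μ : Measure X) (B A : Set X) :
    (ProbabilityTheory.cond μ B A).toReal ≤ 1 :=
  ENNReal.toReal_le_of_le_ofReal zero_le_one (by simpa using prob_le_one)

lemma entPart_cond_nonneg (μ : Measure X) (B : Set X) (α : Finset (Set X)) :
    0 ≤ entPart (ProbabilityTheory.cond μ B) α :=
  Finset.sum_nonneg fun A _ => negMulLog_nonneg ENNReal.toReal_nonneg (toReal_cond_le_one μ B A)

lemma covEnt_cond_le_entPart (μ : Measure X) (B : Set X) {𝒰 α : Finset (Set X)}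
    (hα : IsPartition α) (hαm : MeasF α) (hα𝒰 : Refines α 𝒰) :
    covEnt (ProbabilityTheory.cond μ B) 𝒰 ≤ entPart (ProbabilityTheory.cond μ B) α := by
  refine csInf_le ⟨0, ?_⟩ ⟨α, hα, hαm, hα𝒰, rfl⟩
  rintro _ ⟨α', -, -, -, rfl⟩
  exact entPart_cond_nonneg μ B α'

/-- Jensen's inequality for the entropy along a finite measurable decomposition `s` of `C`. -/
lemma sum_mul_entPart_cond_le (μ : Measure X) [IsFiniteMeasure μ] {s : Finset (Set X)} {C : Set X}
    (hsm : MeasF s) (hs : ∀ A ∈ s, ∀ B ∈ s, A ≠ B → Disjoint A B)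
    (hC : ⋃₀ (s : Set (Set X)) = C) {α : Finset (Set X)} (hα : MeasF α) :
    ∑ B ∈ s, (μ B).toReal * entPart (ProbabilityTheory.cond μ B) α
      ≤ (μ C).toReal * entPart (ProbabilityTheory.cond μ C) α := by
  have hCm : MeasurableSet C := hC ▸ s.finite_toSet.measurableSet_sUnion hsm
  have hadd : ∀ A, MeasurableSet A → ∑ B ∈ s, (μ (A ∩ B)).toReal = (μ (A ∩ C)).toReal := by
    intro A hA
    rw [← hC, Set.sUnion_eq_biUnion, Set.inter_iUnion₂, ← ENNReal.toReal_sum (by simp)]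
    congr 1
    refine (measure_biUnion_finset ?_ fun B hB => hA.inter (hsm B hB)).symm
    exact fun B hB B' hB' h => (hs B hB B' hB' h).mono Set.inter_subset_right Set.inter_subset_right
  have hsum : ∑ B ∈ s, (μ B).toReal = (μ C).toReal := by
    simpa using hadd Set.univ MeasurableSet.univ
  simp only [entPart, Finset.mul_sum]
  rw [Finset.sum_comm]
  refine Finset.sum_le_sum fun A hA => ?_
  rcases (ENNReal.toReal_nonneg (a := μ C)).eq_or_lt with h0 | hpos
  · rw [← h0, zero_mul]
    refine (Finset.sum_eq_zero fun B hB => ?_).le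
    rw [(Finset.sum_eq_zero_iff_of_nonneg fun _ _ => ENNReal.toReal_nonneg).1
      (hsum.trans h0.symm) B hB, zero_mul]
  · have hJ := concaveOn_negMulLog.le_map_sum (t := s)
      (w := fun B => (μ B).toReal / (μ C).toReal)
      (p := fun B => (ProbabilityTheory.cond μ B A).toReal)
      (fun _ _ => by positivity)
      (by rw [← Finset.sum_div, hsum, div_self hpos.ne'])
      (fun _ _ => ENNReal.toReal_nonneg)
    have hmean : ∑ B ∈ s, ((μ B).toReal / (μ C).toReal) • (ProbabilityTheory.cond μ B A).toReal
        = (ProbabilityTheory.cond μ C A).toReal := by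
      simp only [smul_eq_mul, div_mul_eq_mul_div]
      rw [← Finset.sum_div, Finset.sum_congr rfl fun B hB => toReal_mul_cond μ (hsm B hB) A,
        hadd A (hα A hA), ← toReal_mul_cond μ hCm A, mul_div_cancel_left₀ _ hpos.ne']
    rw [hmean] at hJ
    simp only [smul_eq_mul, div_mul_eq_mul_div] at hJ
    rwa [← Finset.sum_div, div_le_iff₀' hpos] at hJ

lemma sum_mul_covEnt_cond_le (μ : Measure X) [IsFiniteMeasure μ] {s : Finset (Set X)} {C : Set X}
    (hsm : MeasF s) (hs : ∀ A ∈ s, ∀ B ∈ s, A ≠ B → Disjoint A B)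
    (hC : ⋃₀ (s : Set (Set X)) = C) (𝒰 : Finset (Set X)) :
    ∑ B ∈ s, (μ B).toReal * covEnt (ProbabilityTheory.cond μ B) 𝒰
      ≤ (μ C).toReal * covEnt (ProbabilityTheory.cond μ C) 𝒰 := by
  by_cases hne : ∃ α : Finset (Set X), IsPartition α ∧ MeasF α ∧ Refines α 𝒰
  · obtain ⟨α₀, h₀⟩ := hne
    rcases (ENNReal.toReal_nonneg (a := μ C)).eq_or_lt with h0 | hpos
    · have h := sum_mul_entPart_cond_le μ hsm hs hC h₀.2.1
      rw [← h0, zero_mul] at h ⊢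
      refine le_trans (Finset.sum_le_sum fun B _ => ?_) h
      exact mul_le_mul_of_nonneg_left (covEnt_cond_le_entPart μ B h₀.1 h₀.2.1 h₀.2.2)
        ENNReal.toReal_nonneg
    · rw [← div_le_iff₀' hpos]
      refine le_csInf ⟨_, α₀, h₀.1, h₀.2.1, h₀.2.2, rfl⟩ ?_
      rintro _ ⟨α, hα, hαm, hα𝒰, rfl⟩
      rw [div_le_iff₀' hpos]
      refine le_trans (Finset.sum_le_sum fun B _ => ?_)
        (sum_mul_entPart_cond_le μ hsm hs hC hαm)
      exact mul_le_mul_of_nonneg_left (covEnt_cond_le_entPart μ B hα hαm hα𝒰)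
        ENNReal.toReal_nonneg
  · have hzero : ∀ ν : Measure X, covEnt ν 𝒰 = 0 := by
      intro ν
      refine (congrArg sInf (Set.eq_empty_of_forall_notMem ?_)).trans Real.sInf_empty
      rintro _ ⟨α, hα, hαm, hα𝒰, -⟩
      exact hne ⟨α, hα, hαm, hα𝒰⟩
    simp [hzero]

end Paper

open Paper MeasureTheory Real Filter

/-- For a Borel probability measure `μ` on a compact metric space `X`,
a cover `𝒰` and partitions `β, γ`: if `β ≽ γ` then `H_μ(𝒰|β) ≤ H_μ(𝒰|γ)`. -/
theorem statement7 {X : Type*} [MetricSpace X] [CompactSpace X]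
    [MeasurableSpace X] [BorelSpace X]
    (μ : MeasureTheory.Measure X) [MeasureTheory.IsProbabilityMeasure μ]
    (𝒰 β γ : Finset (Set X)) (h𝒰 : IsCover 𝒰) (h𝒰m : MeasF 𝒰)
    (hβ : IsPartition β) (hβm : MeasF β) (hγ : IsPartition γ) (hγm : MeasF γ)
    (hβγ : Refines β γ) :
    covEntCond μ 𝒰 β ≤ covEntCond μ 𝒰 γ := by
  classical
  choose! g hg hsub using hβγ
  unfold covEntCond
  rw [← Finset.sum_fiberwise_of_maps_to hg]
  refine Finset.sum_le_sum fun C hC => ?_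
  refine sum_mul_covEnt_cond_le μ (fun B hB => hβm B (Finset.mem_filter.1 hB).1)
    (fun A hA B hB => hβ.2 A (Finset.mem_filter.1 hA).1 B (Finset.mem_filter.1 hB).1) ?_ 𝒰
  refine Set.Subset.antisymm (Set.sUnion_subset fun B hB => ?_) fun x hx => ?_
  · obtain ⟨hBβ, rfl⟩ := Finset.mem_filter.1 hB
    exact hsub B hBβ
  · obtain ⟨B, hB, hxB⟩ : x ∈ ⋃₀ (β : Set (Set X)) := hβ.1 ▸ Set.mem_univ x
    refine ⟨B, Finset.mem_filter.2 ⟨hB, ?_⟩, hxB⟩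
    by_contra hne
    exact Set.disjoint_left.1 (hγ.2 _ (hg B hB) C hC hne) (hsub B hB hxB) hx
end

section
/- Let (X,T) be a TDS, U a cover of X, β a partition of X, and let α_1, ..., α_K be finite partitions of X each finer than U (α_l ≽ U for all 1 ≤ l ≤ K). Let N ∈ ℕ and let B be an atom of β_0^{N-1} at which the maximum defining N(U_0^{N-1} | β_0^{N-1}) is attained, i.e. N(U_0^{N-1} ∩ B) = N(U_0^{N-1} | β_0^{N-1}). Then there exists a finite subset P ⊆ B such that every element of (α_l)_0^{N-1} contains at most one point of P for every 1 ≤ l ≤ K, and |P| ≥ N(U_0^{N-1} | β_0^{N-1}) / K. -/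
open MeasureTheory Real Filter

namespace Paper

variable {X : Type*}

lemma mem_join {𝒰 𝒱 : Finset (Set X)} {A : Set X} :
    A ∈ join 𝒰 𝒱 ↔ ∃ U ∈ 𝒰, ∃ V ∈ 𝒱, U ∩ V = A := by
  simp only [join, Finset.mem_image, Finset.mem_product, Prod.exists]
  grind

lemma mem_pre {f : X → X} {𝒰 : Finset (Set X)} {A : Set X} :
    A ∈ pre f 𝒰 ↔ ∃ U ∈ 𝒰, f ⁻¹' U = A := by
  simp [pre]

lemma isCover_iff {𝒰 : Finset (Set X)} : IsCover 𝒰 ↔ ∀ x, ∃ U ∈ 𝒰, x ∈ U := by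
  simp [IsCover, Set.eq_univ_iff_forall]

lemma IsPartition.join {α γ : Finset (Set X)} (hα : IsPartition α) (hγ : IsPartition γ) :
    IsPartition (join α γ) := by
  refine ⟨isCover_iff.2 fun x => ?_, fun A hA B hB hAB => ?_⟩
  · obtain ⟨U, hU, hxU⟩ := isCover_iff.1 hα.1 x
    obtain ⟨V, hV, hxV⟩ := isCover_iff.1 hγ.1 x
    exact ⟨U ∩ V, mem_join.2 ⟨U, hU, V, hV, rfl⟩, hxU, hxV⟩
  · obtain ⟨U, hU, V, hV, rfl⟩ := mem_join.1 hA
    obtain ⟨U', hU', V', hV', rfl⟩ := mem_join.1 hB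
    by_cases hUU' : U = U'
    · have hVV' : V ≠ V' := fun h => hAB (by rw [hUU', h])
      exact (hγ.2 V hV V' hV' hVV').mono Set.inter_subset_right Set.inter_subset_right
    · exact (hα.2 U hU U' hU' hUU').mono Set.inter_subset_left Set.inter_subset_left

lemma IsPartition.pre {α : Finset (Set X)} (hα : IsPartition α) (f : X → X) :
    IsPartition (pre f α) := by
  refine ⟨isCover_iff.2 fun x => ?_, fun A hA B hB hAB => ?_⟩
  · obtain ⟨U, hU, hxU⟩ := isCover_iff.1 hα.1 (f x)
    exact ⟨f ⁻¹' U, mem_pre.2 ⟨U, hU, rfl⟩, hxU⟩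
  · obtain ⟨U, hU, rfl⟩ := mem_pre.1 hA
    obtain ⟨V, hV, rfl⟩ := mem_pre.1 hB
    exact (hα.2 U hU V hV fun h => hAB (by rw [h])).preimage f

lemma IsPartition.dynJoin {α : Finset (Set X)} (hα : IsPartition α) (f : X → X) (N : ℕ) :
    IsPartition (dynJoin f α N) := by
  induction N with
  | zero => simp [Paper.dynJoin, IsPartition, IsCover]
  | succ N ih => exact ih.join (hα.pre _)

lemma Refines.dynJoin {α 𝒰 : Finset (Set X)} (h : Refines α 𝒰) (f : X → X) (N : ℕ) :
    Refines (dynJoin f α N) (dynJoin f 𝒰 N) := by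
  induction N with
  | zero => exact fun A hA => ⟨A, hA, subset_rfl⟩
  | succ N ih =>
    intro A hA
    obtain ⟨V, hV, W, hW, rfl⟩ := mem_join.1 hA
    obtain ⟨S, hS, rfl⟩ := mem_pre.1 hW
    obtain ⟨V', hV', hVV'⟩ := ih V hV
    obtain ⟨S', hS', hSS'⟩ := h S hS
    exact ⟨V' ∩ f^[N] ⁻¹' S', mem_join.2 ⟨V', hV', _, mem_pre.2 ⟨S', hS', rfl⟩, rfl⟩,
      Set.inter_subset_inter hVV' (Set.preimage_mono hSS')⟩

lemma covNum_le_card {𝒰 𝒱 : Finset (Set X)} {B : Set X} (h𝒱 : 𝒱 ⊆ 𝒰)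
    (hB : B ⊆ ⋃₀ (𝒱 : Set (Set X))) : covNum 𝒰 B ≤ 𝒱.card :=
  Nat.sInf_le ⟨𝒱, h𝒱, rfl, hB⟩

/-- A finite set `P` with `K * |P| < N(𝒰 ∩ B)` misses, for some point `x ∈ B`, all the atoms
containing `x` of the `K` given partitions finer than `𝒰`. -/
lemma exists_mem_forall_inter_eq_empty {𝒰 : Finset (Set X)} {B : Set X} {K : ℕ}
    {γ : Fin K → Finset (Set X)} (hγ : ∀ l, IsPartition (γ l)) (href : ∀ l, Refines (γ l) 𝒰)
    {P : Finset X} (hP : K * P.card < covNum 𝒰 B) :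
    ∃ x ∈ B, ∀ l, ∀ A ∈ γ l, x ∈ A → A ∩ (↑P : Set X) = ∅ := by
  classical
  have hatom : ∀ l x, ∃ U ∈ 𝒰, ∀ A ∈ γ l, x ∈ A → A ⊆ U := fun l x => by
    obtain ⟨A, hA, hxA⟩ := isCover_iff.1 (hγ l).1 x
    obtain ⟨U, hU, hAU⟩ := href l A hA
    refine ⟨U, hU, fun A' hA' hxA' => ?_⟩
    by_cases h : A' = A
    · exact h ▸ hAU
    · exact (Set.disjoint_left.1 ((hγ l).2 A' hA' A hA h) hxA' hxA).elim
  choose U hU hsub using hatom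
  by_contra! hcon
  let 𝒱 : Finset (Set X) := (Finset.univ ×ˢ P).image fun q => U q.1 q.2
  have hcover : B ⊆ ⋃₀ (𝒱 : Set (Set X)) := fun x hx => by
    obtain ⟨l, A, hA, hxA, p, hpA, hpP⟩ := hcon x hx
    refine ⟨U l p, ?_, hsub l p A hA hpA hxA⟩
    exact Finset.mem_image.2 ⟨(l, p), by simpa using hpP, rfl⟩
  have h𝒱 : 𝒱 ⊆ 𝒰 := fun V hV => by
    obtain ⟨q, -, rfl⟩ := Finset.mem_image.1 hV
    exact hU _ _
  have hcard : 𝒱.card ≤ K * P.card := by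
    simpa using Finset.card_image_le (s := (Finset.univ : Finset (Fin K)) ×ˢ P)
      (f := fun q => U q.1 q.2)
  have := covNum_le_card h𝒱 hcover
  omega

lemma exists_separated_covNum_le {𝒰 : Finset (Set X)} {B : Set X} {K : ℕ} (hK : 0 < K)
    {γ : Fin K → Finset (Set X)} (hγ : ∀ l, IsPartition (γ l)) (href : ∀ l, Refines (γ l) 𝒰) :
    ∃ P : Finset X, ↑P ⊆ B ∧ (∀ l, ∀ A ∈ γ l, (A ∩ (↑P : Set X)).Subsingleton) ∧
      covNum 𝒰 B ≤ K * P.card := by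
  classical
  by_contra! hcon
  have hlarge : ∀ n : ℕ, ∃ P : Finset X, ↑P ⊆ B ∧
      (∀ l, ∀ A ∈ γ l, (A ∩ (↑P : Set X)).Subsingleton) ∧ P.card = n := fun n => by
    induction n with
    | zero => exact ⟨∅, by simp⟩
    | succ n ih =>
      obtain ⟨P, hPB, hPsep, rfl⟩ := ih
      obtain ⟨x, hxB, hx⟩ := exists_mem_forall_inter_eq_empty hγ href (hcon P hPB hPsep)
      have hxP : x ∉ P := fun hxP => by
        obtain ⟨A, hA, hxA⟩ := isCover_iff.1 (hγ ⟨0, hK⟩).1 x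
        exact (hx _ A hA hxA).le ⟨hxA, hxP⟩
      refine ⟨insert x P, ?_, fun l A hA => ?_, Finset.card_insert_of_notMem hxP⟩
      · rw [Finset.coe_insert]
        exact Set.insert_subset hxB hPB
      · rw [Finset.coe_insert]
        by_cases hxA : x ∈ A
        · rw [Set.inter_insert_of_mem hxA, hx l A hA hxA]
          simp
        · rw [Set.inter_insert_of_notMem hxA]
          exact hPsep l A hA
  obtain ⟨P, hPB, hPsep, hPcard⟩ := hlarge (covNum 𝒰 B)
  have := hcon P hPB hPsep
  nlinarith

end Paper

open Paper MeasureTheory Real Filter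

/-- Let `(X,T)` be a TDS, `𝒰` a cover of `X`, `β` a partition of `X`, and
`α_1, …, α_K` measurable partitions finer than `𝒰`. Let `N ∈ ℕ` and `B ∈ β_0^{N-1}` an
atom where the maximum defining `N(𝒰_0^{N-1}|β_0^{N-1})` is attained. Then there is a
finite `P ⊆ B` such that every element of `(α_l)_0^{N-1}` contains at most one point of
`P` for each `l`, and `|P| ≥ N(𝒰_0^{N-1}|β_0^{N-1}) / K`. -/
theorem statement12 {X : Type*} [MetricSpace X] [CompactSpace X]
    [MeasurableSpace X] [BorelSpace X] (T : X ≃ₜ X)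
    (𝒰 β : Finset (Set X)) (h𝒰 : IsCover 𝒰) (h𝒰m : MeasF 𝒰)
    (hβ : IsPartition β) (hβm : MeasF β)
    {K : ℕ} (hK : 0 < K) (α : Fin K → Finset (Set X))
    (hαpart : ∀ l, IsPartition (α l)) (hαmeas : ∀ l, MeasF (α l))
    (hαref : ∀ l, Refines (α l) 𝒰)
    {N : ℕ} (hN : 0 < N) (B : Set X) (hB : B ∈ dynJoin (⇑T) β N)
    (hBmax : covNum (dynJoin (⇑T) 𝒰 N) B =
      covNumCond (dynJoin (⇑T) 𝒰 N) (dynJoin (⇑T) β N)) :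
    ∃ P : Finset X, ↑P ⊆ B ∧
      (∀ l : Fin K, ∀ A ∈ dynJoin (⇑T) (α l) N, (A ∩ (↑P : Set X)).Subsingleton) ∧
      (covNumCond (dynJoin (⇑T) 𝒰 N) (dynJoin (⇑T) β N) : ℝ) / (K : ℝ) ≤ (P.card : ℝ) := by
  obtain ⟨P, hPB, hPsep, hPcard⟩ := exists_separated_covNum_le (B := B) hK
    (fun l => (hαpart l).dynJoin T N) (fun l => (hαref l).dynJoin T N)
  refine ⟨P, hPB, hPsep, ?_⟩
  rw [← hBmax, div_le_iff₀' (by exact_mod_cast hK)]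
  exact_mod_cast hPcard
end

section
/- Let (X,T) be an invertible TDS. Then for every N ∈ ℕ and every ε > 0 there exists a Borel set D ⊆ X such that D, TD, ..., T^{N-1}D are pairwise disjoint and μ(⋃_{n=0}^{N-1} T^n D) > 1 - ε for every non-atomic ergodic T-invariant Borel probability measure μ on X. -/
open MeasureTheory Real Filter

open Paper MeasureTheory Real Filter

open scoped Topology

namespace Homeomorph

section Topological

variable {X : Type*} [TopologicalSpace X] (T : X ≃ₜ X)

lemma coe_pow_eq_iterate (n : ℕ) : ⇑(T ^ n) = (⇑T)^[n] :=
  hom_coe_pow DFunLike.coe rfl (fun _ _ => rfl) T n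

lemma zpow_add_apply (m n : ℤ) (x : X) : (T ^ (m + n)) x = (T ^ m) ((T ^ n) x) := by
  rw [zpow_add]; rfl

lemma mem_iterate_image_iff (n : ℕ) (D : Set X) (x : X) :
    x ∈ (⇑T)^[n] '' D ↔ (T ^ (-n : ℤ)) x ∈ D := by
  have h : ⇑(T ^ (n : ℤ)) = (⇑T)^[n] := by rw [zpow_natCast, coe_pow_eq_iterate]
  rw [← h]
  constructor
  · rintro ⟨y, hy, rfl⟩
    rw [← zpow_add_apply]
    simpa using hy
  · intro hx
    refine ⟨_, hx, ?_⟩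
    rw [← zpow_add_apply]
    simp

/-- A set whose first `M` translates under `T` are pairwise disjoint. -/
def IsMarker (M : ℕ) (A : Set X) : Prop :=
  ∀ k : ℕ, 0 < k → k < M → ∀ x ∈ A, (T ^ (k : ℤ)) x ∉ A

variable {T}

lemma IsMarker.mono {M : ℕ} {A B : Set X} (hB : T.IsMarker M B) (h : A ⊆ B) :
    T.IsMarker M A :=
  fun k hk hkM x hx hx' => hB k hk hkM x (h hx) (h hx')

lemma exists_mem_nhds_isMarker [T2Space X] (M : ℕ) {x : X}
    (hx : ∀ n : ℕ, 0 < n → (T ^ (n : ℤ)) x ≠ x) :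
    ∃ U ∈ 𝓝 x, T.IsMarker M U := by
  have key : ∀ k : ℕ, ∃ U ∈ 𝓝 x, 0 < k → ∀ y ∈ U, (T ^ (k : ℤ)) y ∉ U := by
    intro k
    by_cases hk : 0 < k
    · obtain ⟨U, V, hU, hV, hxU, hxV, hUV⟩ := t2_separation (hx k hk)
      refine ⟨V ∩ (T ^ (k : ℤ)) ⁻¹' U, Filter.inter_mem (hV.mem_nhds hxV)
        ((T ^ (k : ℤ)).continuous.continuousAt.preimage_mem_nhds (hU.mem_nhds hxU)), ?_⟩
      rintro - y hy hy'
      exact Set.disjoint_left.1 hUV hy.2 hy'.1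
    · exact ⟨_root_.Set.univ, Filter.univ_mem, fun h => absurd h hk⟩
  choose U hU hU' using key
  refine ⟨⋂ k ∈ Finset.range M, U k, (Filter.biInter_finset_mem _).2 fun k _ => hU k, ?_⟩
  intro k hk hkM y hy hy'
  rw [← Finset.mem_range] at hkM
  exact hU' k hk y (Set.mem_iInter₂.1 hy k hkM) (Set.mem_iInter₂.1 hy' k hkM)

variable (T) in
/-- Countably many measurable markers cover the aperiodic points. -/
lemma exists_seq_isMarker [T2Space X] [SecondCountableTopology X] [MeasurableSpace X]
    [BorelSpace X] (M : ℕ) :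
    ∃ U : ℕ → Set X, (∀ n, MeasurableSet (U n)) ∧ (∀ n, T.IsMarker M (U n)) ∧
      ∀ x, (∀ n : ℕ, 0 < n → (T ^ (n : ℤ)) x ≠ x) → ∃ n, x ∈ U n := by
  let S : Set (Set X) := insert ∅ {b ∈ TopologicalSpace.countableBasis X | T.IsMarker M b}
  have hS : S.Countable :=
    ((TopologicalSpace.countable_countableBasis X).mono (Set.sep_subset _ _)).insert _
  obtain ⟨U, hU⟩ := hS.exists_eq_range ⟨∅, Set.mem_insert _ _⟩
  have hmem : ∀ n, U n ∈ S := fun n => hU ▸ Set.mem_range_self n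
  refine ⟨U, fun n => ?_, fun n => ?_, fun x hx => ?_⟩
  · rcases hmem n with h | h
    · rw [h]; exact MeasurableSet.empty
    · exact (TopologicalSpace.isOpen_of_mem_countableBasis h.1).measurableSet
  · rcases hmem n with h | h
    · rw [h]; exact fun _ _ _ x hx => absurd hx (Set.notMem_empty x)
    · exact h.2
  · obtain ⟨V, hV, hVM⟩ := exists_mem_nhds_isMarker M hx
    obtain ⟨b, hb, hxb, hbV⟩ :=
      (TopologicalSpace.isBasis_countableBasis X).mem_nhds_iff.1 hV
    have hbS : b ∈ S := Set.mem_insert_of_mem _ ⟨hb, hVM.mono hbV⟩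
    rw [hU] at hbS
    obtain ⟨n, rfl⟩ := hbS
    exact ⟨n, hxb⟩

/-- The points whose orbit meets `A` at a time `i` with `|i| < M`. -/
def orbitThickening (T : X ≃ₜ X) (M : ℕ) (A : Set X) : Set X :=
  {x | ∃ i : ℤ, |i| < M ∧ (T ^ i) x ∈ A}

lemma measurableSet_orbitThickening [MeasurableSpace X] [BorelSpace X] (M : ℕ) {A : Set X}
    (hA : MeasurableSet A) : MeasurableSet (T.orbitThickening M A) := by
  have h : T.orbitThickening M A = ⋃ i : ℤ, ⋃ _ : |i| < M, (T ^ i) ⁻¹' A := by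
    ext x; simp [orbitThickening]
  rw [h]
  exact MeasurableSet.iUnion fun i => MeasurableSet.iUnion fun _ =>
    (T ^ i).continuous.measurable hA

lemma IsMarker.union_diff_orbitThickening {M : ℕ} {A U : Set X} (hA : T.IsMarker M A)
    (hU : T.IsMarker M U) : T.IsMarker M (A ∪ (U \ T.orbitThickening M A)) := by
  rintro k hk hkM x (hx | hx) (hx' | hx')
  · exact hA k hk hkM x hx hx'
  · refine hx'.2 ⟨-k, by simpa using hkM, ?_⟩
    rw [← zpow_add_apply]
    simpa using hx
  · exact hx.2 ⟨k, by simpa using hkM, hx'⟩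
  · exact hU k hk hkM x hx.1 hx'.1

/-- A greedy maximal marker built out of the sets `U n`. -/
def greedyMarker (T : X ≃ₜ X) (M : ℕ) (U : ℕ → Set X) : ℕ → Set X
  | 0 => ∅
  | n + 1 => greedyMarker T M U n ∪ (U n \ T.orbitThickening M (greedyMarker T M U n))

variable (T) in
/-- **Marker lemma**: there is a measurable marker that the past of each aperiodic point meets. -/
lemma exists_isMarker [T2Space X] [SecondCountableTopology X] [MeasurableSpace X]
    [BorelSpace X] {M : ℕ} (hM : 0 < M) :
    ∃ A : Set X, MeasurableSet A ∧ T.IsMarker M A ∧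
      ∀ x, (∀ n : ℕ, 0 < n → (T ^ (n : ℤ)) x ≠ x) → ∃ n : ℕ, (T ^ (-n : ℤ)) x ∈ A := by
  obtain ⟨U, hUm, hUM, hU⟩ := exists_seq_isMarker T M
  set G := greedyMarker T M U
  have hmono : Monotone G := monotone_nat_of_le_succ fun n => Set.subset_union_left
  refine ⟨⋃ n, G n, MeasurableSet.iUnion fun n => ?_, ?_, fun x hx => ?_⟩
  · induction n with
    | zero => exact MeasurableSet.empty
    | succ n ih => exact ih.union ((hUm n).diff (measurableSet_orbitThickening M ih))
  · have hGM : ∀ n, T.IsMarker M (G n) := by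
      intro n
      induction n with
      | zero => exact fun _ _ _ x hx => absurd hx (Set.notMem_empty x)
      | succ n ih => exact ih.union_diff_orbitThickening (hUM n)
    intro k hk hkM x hx hx'
    obtain ⟨m, hm⟩ := Set.mem_iUnion.1 hx
    obtain ⟨n, hn⟩ := Set.mem_iUnion.1 hx'
    exact hGM (max m n) k hk hkM x (hmono (le_max_left _ _) hm) (hmono (le_max_right _ _) hn)
  · have hy : ∀ n : ℕ, 0 < n →
        (T ^ (n : ℤ)) ((T ^ (-M : ℤ)) x) ≠ (T ^ (-M : ℤ)) x := by
      intro n hn h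
      rw [← zpow_add_apply, add_comm, zpow_add_apply] at h
      exact hx n hn ((T ^ (-M : ℤ)).injective h)
    obtain ⟨n, hn⟩ := hU _ hy
    have hthick : ∃ i : ℤ, |i| < M ∧ (T ^ i) ((T ^ (-M : ℤ)) x) ∈ ⋃ n, G n := by
      by_cases h : (T ^ (-M : ℤ)) x ∈ T.orbitThickening M (G n)
      · obtain ⟨i, hi, hiG⟩ := h
        exact ⟨i, hi, Set.mem_iUnion.2 ⟨n, hiG⟩⟩
      · exact ⟨0, by simpa using hM, Set.mem_iUnion.2 ⟨n + 1, Or.inr ⟨hn, h⟩⟩⟩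
    obtain ⟨i, hi, hiG⟩ := hthick
    rw [← zpow_add_apply] at hiG
    have := abs_lt.1 hi
    refine ⟨(M - i).toNat, ?_⟩
    convert hiG using 3
    omega

/-- The base of the tower of height `N` obtained by cutting the orbit segments between
consecutive visits to `A` into blocks of length `N`, dropping the incomplete last blocks. -/
def towerBase (T : X ≃ₜ X) (N : ℕ) (A : Set X) : Set X :=
  {x | (∃ q : ℕ, (T ^ (-(N * q : ℕ) : ℤ)) x ∈ A ∧
      ∀ m : ℕ, m < N * q → (T ^ (-m : ℤ)) x ∉ A) ∧
    ∀ j : ℕ, 0 < j → j < N → (T ^ (j : ℤ)) x ∉ A}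

lemma measurableSet_towerBase [MeasurableSpace X] [BorelSpace X] (N : ℕ) {A : Set X}
    (hA : MeasurableSet A) : MeasurableSet (T.towerBase N A) := by
  have h (i : ℤ) : MeasurableSet {x | (T ^ i) x ∈ A} := (T ^ i).continuous.measurable hA
  refine MeasurableSet.inter (measurableSet_setOfPred.2 ?_) (measurableSet_setOfPred.2 ?_)
  · refine Measurable.exists fun q => (h _).mem.and (Measurable.forall fun m => ?_)
    exact measurable_const.imp (h _).mem.not
  · refine Measurable.forall fun m => measurable_const.imp (measurable_const.imp ?_)
    exact (h _).mem.not

lemma zpow_notMem_towerBase {N k : ℕ} {A : Set X} (hk : 0 < k) (hkN : k < N) {x : X}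
    (hx : x ∈ T.towerBase N A) : (T ^ (k : ℤ)) x ∉ T.towerBase N A := by
  rintro ⟨⟨q', hq', hm'⟩, -⟩
  obtain ⟨⟨q, hq, hm⟩, hj⟩ := hx
  have hlast : N * q' = N * q + k := by
    apply le_antisymm
    · by_contra! hlt
      refine hm' _ hlt ?_
      rw [← zpow_add_apply]
      convert hq using 3
      push_cast; ring
    · by_contra! hlt
      rw [← zpow_add_apply] at hq'
      rcases lt_or_ge (N * q') k with h | h
      · refine hj (k - N * q') (by omega) (by omega) ?_
        convert hq' using 3
        omega
      · refine hm (N * q' - k) (by omega) ?_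
        convert hq' using 3
        omega
  have hdvd : N ∣ k := (Nat.dvd_add_right (dvd_mul_right N q)).1 (hlast ▸ dvd_mul_right N q')
  exact absurd (Nat.le_of_dvd hk hdvd) (by omega)

variable (T) in
lemma disjoint_iterate_image_towerBase (N : ℕ) (A : Set X) {i j : ℕ} (hi : i < N) (hj : j < N)
    (hij : i ≠ j) :
    Disjoint ((⇑T)^[i] '' T.towerBase N A) ((⇑T)^[j] '' T.towerBase N A) := by
  wlog hlt : i < j generalizing i j
  · exact (this hj hi hij.symm (by omega)).symm
  rw [Set.disjoint_left]
  intro x hxi hxj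
  rw [mem_iterate_image_iff] at hxi hxj
  refine zpow_notMem_towerBase (k := j - i) (by omega) (by omega) hxj ?_
  rw [← zpow_add_apply]
  convert hxi using 3
  omega

/-- Points outside the tower over `towerBase N A` enter `A` within time `N`. -/
lemma exists_zpow_mem_of_notMem_tower {N : ℕ} (hN : 0 < N) {A : Set X} {x : X}
    (hxA : ∃ n : ℕ, (T ^ (-n : ℤ)) x ∈ A)
    (hx : x ∉ ⋃ i ∈ Finset.range N, (⇑T)^[i] '' T.towerBase N A) :
    ∃ k ∈ Finset.range N, (⇑T)^[k] x ∈ A := by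
  classical
  have hmod := Nat.mod_lt (Nat.find hxA) hN
  have hdiv := Nat.div_add_mod (Nat.find hxA) N
  have hnot : (T ^ (-(Nat.find hxA % N : ℕ) : ℤ)) x ∉ T.towerBase N A := by
    intro h
    refine hx (Set.mem_iUnion₂.2 ⟨_, Finset.mem_range.2 hmod, ?_⟩)
    rwa [mem_iterate_image_iff]
  have hfirst : ∃ q : ℕ, (T ^ (-(N * q : ℕ) : ℤ)) ((T ^ (-(Nat.find hxA % N : ℕ) : ℤ)) x) ∈ A ∧
      ∀ m : ℕ, m < N * q → (T ^ (-m : ℤ)) ((T ^ (-(Nat.find hxA % N : ℕ) : ℤ)) x) ∉ A := by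
    refine ⟨Nat.find hxA / N, ?_, fun m hm hmA => ?_⟩
    · rw [← zpow_add_apply]
      convert Nat.find_spec hxA using 3
      omega
    · rw [← zpow_add_apply] at hmA
      refine Nat.find_min hxA (m := m + Nat.find hxA % N) (by omega) ?_
      convert hmA using 3
      push_cast; ring
  have hvisit : ∃ j : ℕ, 0 < j ∧ j < N ∧
      (T ^ (j : ℤ)) ((T ^ (-(Nat.find hxA % N : ℕ) : ℤ)) x) ∈ A := by
    by_contra! h
    exact hnot ⟨hfirst, h⟩
  obtain ⟨j, hj, hjN, hjA⟩ := hvisit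
  rw [← zpow_add_apply] at hjA
  rcases lt_or_ge j (Nat.find hxA % N) with h | h
  · refine absurd ?_ (Nat.find_min hxA (m := Nat.find hxA % N - j)
      (by have := Nat.mod_le (Nat.find hxA) N; omega))
    convert hjA using 3
    omega
  · refine ⟨j - Nat.find hxA % N, Finset.mem_range.2 (by omega), ?_⟩
    rw [← coe_pow_eq_iterate, ← zpow_natCast]
    convert hjA using 3
    omega

lemma IsMarker.mul_measure_le [MeasurableSpace X] {M : ℕ} {A : Set X} (hA : T.IsMarker M A)
    (hAm : MeasurableSet A) {μ : Measure X} (hT : MeasurePreserving T μ μ) :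
    M * μ A ≤ μ _root_.Set.univ := by
  have hdisj : ((Finset.range M : Finset ℕ) : Set ℕ).PairwiseDisjoint
      fun k => (⇑T)^[k] ⁻¹' A := by
    intro i hi j hj hij
    change Disjoint _ _
    rw [Finset.mem_coe, Finset.mem_range] at hi hj
    wlog hlt : i < j generalizing i j
    · exact (this hj hi hij.symm (by omega)).symm
    refine Set.disjoint_left.2 fun x hxi hxj => hA (j - i) (by omega) (by omega) _ hxi ?_
    rw [zpow_natCast, coe_pow_eq_iterate, ← Function.iterate_add_apply,
      Nat.sub_add_cancel hlt.le]
    exact hxj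
  have hmeas : ∀ k, μ ((⇑T)^[k] ⁻¹' A) = μ A := fun k =>
    (hT.iterate k).measure_preimage hAm.nullMeasurableSet
  calc M * μ A = ∑ k ∈ Finset.range M, μ ((⇑T)^[k] ⁻¹' A) := by simp [hmeas]
    _ = μ (⋃ k ∈ Finset.range M, (⇑T)^[k] ⁻¹' A) :=
      (measure_biUnion_finset hdisj fun k _ => (hT.iterate k).measurable hAm).symm
    _ ≤ μ _root_.Set.univ := measure_mono (Set.subset_univ _)

end Topological

section Ergodic

variable {X : Type*} [MetricSpace X] [SecondCountableTopology X] [MeasurableSpace X]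
  [BorelSpace X] {T : X ≃ₜ X} {μ : Measure X} [IsProbabilityMeasure μ]

lemma measure_periodicPts_eq_zero (hT : Ergodic T μ) (hμ : ∀ x, μ {x} = 0) {n : ℕ}
    (hn : 0 < n) : μ {x | (⇑T)^[n] x = x} = 0 := by
  have hclosed : IsClosed {x | (⇑T)^[n] x = x} :=
    isClosed_eq (T.continuous.iterate n) continuous_id
  have hinv : ⇑T ⁻¹' {x | (⇑T)^[n] x = x} = {x | (⇑T)^[n] x = x} := by
    ext x
    simp only [Set.mem_preimage, Set.mem_ofPred_eq, ← Function.iterate_succ_apply]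
    rw [Function.iterate_succ_apply', T.injective.eq_iff]
  refine (hT.toPreErgodic.prob_eq_zero_or_one hclosed.measurableSet hinv).resolve_right ?_
  intro hone
  have hper : ∀ᵐ x ∂μ, (⇑T)^[n] x = x :=
    (prob_compl_eq_zero_iff hclosed.measurableSet).2 hone
  obtain ⟨x, -, hx⟩ := exists_mem_forall_mem_nhdsWithin_pos_measure
    (μ := μ) (s := _root_.Set.univ) (by simp)
  rw [nhdsWithin_univ] at hx
  let F : X → ℝ := fun y => ∏ i ∈ Finset.range n, dist ((⇑T)^[i] y) x
  have hF : Continuous F := continuous_finsetProd _ fun i _ =>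
    (T.continuous.iterate i).dist continuous_const
  have hFx : F x = 0 := Finset.prod_eq_zero (Finset.mem_range.2 hn) (by simp)
  have hFT : F ∘ T =ᵐ[μ] F := by
    filter_upwards [hper] with y hy
    obtain ⟨m, rfl⟩ := Nat.exists_eq_add_of_lt hn
    rw [zero_add] at hy
    simp only [F, zero_add, Function.comp_apply]
    rw [Finset.prod_range_succ, Finset.prod_range_succ']
    simp only [← Function.iterate_succ_apply]
    rw [hy, Function.iterate_zero_apply]
  obtain ⟨c, hc⟩ := hT.ae_eq_const_of_ae_eq_comp₀ hF.measurable.nullMeasurable hFT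
  have hc0 : c = 0 := by
    by_contra hne
    have hpos := hx _ (hF.continuousAt.preimage_mem_nhds
      (isOpen_ne.mem_nhds (show F x ≠ c by rw [hFx]; exact Ne.symm hne)))
    exact hpos.ne' hc
  have hnull : μ (⋃ i ∈ Finset.range n, (⇑T)^[i] ⁻¹' {x}) = 0 := by
    refine (measure_biUnion_null_iff (Finset.range n).countable_toSet).2 fun i _ => ?_
    rw [(hT.toMeasurePreserving.iterate i).measure_preimage
      (measurableSet_singleton x).nullMeasurableSet, hμ]
  have htop : ∀ᵐ y ∂μ, y ∈ ⋃ i ∈ Finset.range n, (⇑T)^[i] ⁻¹' {x} := by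
    filter_upwards [hc] with y hy
    rw [hc0] at hy
    obtain ⟨i, hi, hyi⟩ := Finset.prod_eq_zero_iff.1 hy
    exact Set.mem_iUnion₂.2 ⟨i, hi, dist_eq_zero.1 hyi⟩
  have : ∀ᵐ y ∂μ, False := by
    filter_upwards [htop, measure_eq_zero_iff_ae_notMem.1 hnull] with y h h' using h' h
  simp [IsProbabilityMeasure.ne_zero μ] at this

lemma ae_aperiodic (hT : Ergodic T μ) (hμ : ∀ x, μ {x} = 0) :
    ∀ᵐ x ∂μ, ∀ n : ℕ, 0 < n → (T ^ (n : ℤ)) x ≠ x := by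
  refine ae_all_iff.2 fun n => ?_
  by_cases hn : 0 < n
  · filter_upwards [measure_eq_zero_iff_ae_notMem.1 (measure_periodicPts_eq_zero hT hμ hn)]
      with x hx _
    rwa [zpow_natCast, coe_pow_eq_iterate]
  · exact .of_forall fun x h => absurd h hn

end Ergodic

end Homeomorph

/-- universal Rohlin lemma: Let `(X,T)` be an invertible TDS. For every
`N ∈ ℕ` and `ε > 0` there is a Borel set `D ⊆ X` such that `D, TD, …, T^{N-1}D` are
pairwise disjoint and `μ(⋃_{n<N} TⁿD) > 1 - ε` for every non-atomic ergodic
`T`-invariant Borel probability measure `μ`. -/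
theorem statement13 {X : Type*} [MetricSpace X] [CompactSpace X]
    [MeasurableSpace X] [BorelSpace X] (T : X ≃ₜ X)
    (N : ℕ) (hN : 0 < N) (ε : ℝ) (hε : 0 < ε) :
    ∃ D : Set X, MeasurableSet D ∧
      (∀ i < N, ∀ j < N, i ≠ j → Disjoint ((⇑T)^[i] '' D) ((⇑T)^[j] '' D)) ∧
      ∀ μ : MeasureTheory.Measure X, MeasureTheory.IsProbabilityMeasure μ →
        Ergodic (⇑T) μ → (∀ x : X, μ {x} = 0) →
        1 - ε < (μ (⋃ i ∈ Finset.range N, (⇑T)^[i] '' D)).toReal := by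
  obtain ⟨M, hM⟩ := exists_nat_gt (N / ε)
  have hM0 : (0 : ℝ) < M := lt_of_le_of_lt (by positivity) hM
  obtain ⟨A, hAm, hAM, hA⟩ := T.exists_isMarker (M := M) (by exact_mod_cast hM0)
  have hDm := Homeomorph.measurableSet_towerBase (T := T) N hAm
  refine ⟨T.towerBase N A, hDm,
    fun i hi j hj hij => T.disjoint_iterate_image_towerBase N A hi hj hij, fun μ _ hT hμ => ?_⟩
  set E := ⋃ i ∈ Finset.range N, (⇑T)^[i] '' T.towerBase N A
  have hEm : MeasurableSet E := Finset.measurableSet_biUnion _ fun i _ => by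
    rw [← Homeomorph.coe_pow_eq_iterate]
    exact (T ^ i).measurableEmbedding.measurableSet_image' hDm
  have hsub : μ.real Eᶜ ≤ N * μ.real A := by
    have hle : μ Eᶜ ≤ ∑ i ∈ Finset.range N, μ ((⇑T)^[i] ⁻¹' A) := by
      refine (measure_mono_ae ?_).trans (measure_biUnion_finset_le _ _)
      filter_upwards [Homeomorph.ae_aperiodic hT hμ] with x hx hxE
      obtain ⟨k, hk, hkA⟩ := Homeomorph.exists_zpow_mem_of_notMem_tower hN (hA x hx) hxE
      exact Set.mem_iUnion₂.2 ⟨k, hk, hkA⟩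
    have hmeas : ∀ k, μ ((⇑T)^[k] ⁻¹' A) = μ A := fun k =>
      (hT.toMeasurePreserving.iterate k).measure_preimage hAm.nullMeasurableSet
    simp only [hmeas, Finset.sum_const, Finset.card_range, nsmul_eq_mul] at hle
    have := ENNReal.toReal_mono (by finiteness) hle
    simpa [Measure.real] using this
  have hMA : M * μ.real A ≤ 1 := by
    have := ENNReal.toReal_mono (by finiteness) (hAM.mul_measure_le hAm hT.toMeasurePreserving)
    simpa [Measure.real] using this
  have hlt : N * μ.real A < ε := by
    rw [div_lt_iff₀ hε] at hM
    have hA0 : 0 ≤ μ.real A := measureReal_nonneg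
    rcases hA0.eq_or_lt with h | h
    · rw [← h, mul_zero]; exact hε
    · nlinarith
  rw [probReal_compl_eq_one_sub hEm] at hsub
  change 1 - ε < μ.real E
  linarith
end
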